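/- For any two subsets S₁, S₂ of C, each of cardinality 12 and each satisfying d·e ∈ {1, 2} for all distinct d, e in the subset, there exists σ ∈ W with σ(S₁) = S₂. -/

import Mathlib

/-- The bilinear form on `Λ = ℤ⁹`: `d·e = d₀e₀ − Σ_{i=1}^{8} dᵢeᵢ`. -/
def dot (d e : Fin 9 → ℤ) : ℤ := d 0 * e 0 - ∑ i : Fin 8, d i.succ * e i.succ

/-- The canonical class `K = (−3, 1, 1, 1, 1, 1, 1, 1, 1)`. -/
def KK : Fin 9 → ℤ := ![-3, 1, 1, 1, 1, 1, 1, 1, 1]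

/-- A vector is exceptional if `d·d = −1` and `d·K = −1`. -/
def IsExceptional (d : Fin 9 → ℤ) : Prop := dot d d = -1 ∧ dot d KK = -1

/-- The set `C` of exceptional vectors. -/
def Cset : Set (Fin 9 → ℤ) := {d | IsExceptional d}

/-- `σ` belongs to the group `W` of permutations of `C` preserving the pairing. -/
def MemW (σ : (Fin 9 → ℤ) → (Fin 9 → ℤ)) : Prop :=
  Set.BijOn σ Cset Cset ∧ ∀ d ∈ Cset, ∀ e ∈ Cset, dot (σ d) (σ e) = dot d e

section Form

theorem dot_eq (d e : Fin 9 → ℤ) :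
    dot d e = d 0 * e 0 - (d 1 * e 1 + d 2 * e 2 + d 3 * e 3 + d 4 * e 4 + d 5 * e 5 + d 6 * e 6 +
      d 7 * e 7 + d 8 * e 8) := by
  simp [dot, Fin.sum_univ_eight]

theorem dot_comm (d e : Fin 9 → ℤ) : dot d e = dot e d := by
  simp only [dot_eq]; ring

theorem dot_add_left (a b e : Fin 9 → ℤ) : dot (a + b) e = dot a e + dot b e := by
  simp only [dot_eq, Pi.add_apply]; ring

theorem dot_smul_left (n : ℤ) (a e : Fin 9 → ℤ) : dot (n • a) e = n * dot a e := by
  simp only [dot_eq, Pi.smul_apply, smul_eq_mul]; ring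

theorem dot_KK (d : Fin 9 → ℤ) :
    dot d KK = -3 * d 0 - (d 1 + d 2 + d 3 + d 4 + d 5 + d 6 + d 7 + d 8) := by
  simp [dot_eq, KK]; ring

/-- Twice the coordinates, in the standard model of `E₈` in `ℝ⁸`, of the projection of `d` to the
orthogonal complement of `KK`. -/
def rootCoord (d : Fin 9 → ℤ) : Fin 8 → ℤ :=
  ![d 0 + d 1 + 2 * d 2, d 0 + d 1 + 2 * d 3, d 0 + d 1 + 2 * d 4, d 0 + d 1 + 2 * d 5,
    d 0 + d 1 + 2 * d 6, d 0 + d 1 + 2 * d 7, d 0 + d 1 + 2 * d 8,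
    5 * d 0 + d 1 + 2 * (d 2 + d 3 + d 4 + d 5 + d 6 + d 7 + d 8)]

theorem sum_rootCoord_mul (d e : Fin 9 → ℤ) :
    ∑ k, rootCoord d k * rootCoord e k = 4 * (dot d KK * dot e KK - dot d e) := by
  rw [dot_KK, dot_KK, dot_eq]
  simp [Fin.sum_univ_eight, rootCoord]
  ring

theorem IsExceptional.sum_rootCoord_mul {d e : Fin 9 → ℤ} (hd : IsExceptional d)
    (he : IsExceptional e) : ∑ k, rootCoord d k * rootCoord e k = 4 * (1 - dot d e) := by
  rw [_root_.sum_rootCoord_mul, hd.2, he.2]; ring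

theorem IsExceptional.sum_sq_rootCoord_add {d e : Fin 9 → ℤ} (hd : IsExceptional d)
    (he : IsExceptional e) : ∑ k, (rootCoord d k + rootCoord e k) ^ 2 = 8 * (3 - dot d e) := by
  have h : ∑ k, (rootCoord d k + rootCoord e k) ^ 2 = ∑ k, rootCoord d k * rootCoord d k +
      2 * ∑ k, rootCoord d k * rootCoord e k + ∑ k, rootCoord e k * rootCoord e k := by
    simp only [Finset.mul_sum, ← Finset.sum_add_distrib]
    exact Finset.sum_congr rfl fun _ _ => by ring
  rw [h, hd.sum_rootCoord_mul hd, hd.sum_rootCoord_mul he, he.sum_rootCoord_mul he, hd.1, he.1]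
  ring

theorem IsExceptional.sum_sq_rootCoord_sub {d e : Fin 9 → ℤ} (hd : IsExceptional d)
    (he : IsExceptional e) : ∑ k, (rootCoord d k - rootCoord e k) ^ 2 = 8 * (1 + dot d e) := by
  have h : ∑ k, (rootCoord d k - rootCoord e k) ^ 2 = ∑ k, rootCoord d k * rootCoord d k -
      2 * ∑ k, rootCoord d k * rootCoord e k + ∑ k, rootCoord e k * rootCoord e k := by
    simp only [Finset.mul_sum, ← Finset.sum_add_distrib, ← Finset.sum_sub_distrib]
    exact Finset.sum_congr rfl fun _ _ => by ring
  rw [h, hd.sum_rootCoord_mul hd, hd.sum_rootCoord_mul he, he.sum_rootCoord_mul he, hd.1, he.1]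
  ring

theorem IsExceptional.neg_one_le_dot {d e : Fin 9 → ℤ} (hd : IsExceptional d)
    (he : IsExceptional e) : -1 ≤ dot d e := by
  have h := hd.sum_sq_rootCoord_sub he
  have : 0 ≤ ∑ k, (rootCoord d k - rootCoord e k) ^ 2 := Finset.sum_nonneg fun _ _ => sq_nonneg _
  linarith

theorem IsExceptional.dot_le_three {d e : Fin 9 → ℤ} (hd : IsExceptional d)
    (he : IsExceptional e) : dot d e ≤ 3 := by
  have h := hd.sum_sq_rootCoord_add he
  have : 0 ≤ ∑ k, (rootCoord d k + rootCoord e k) ^ 2 := Finset.sum_nonneg fun _ _ => sq_nonneg _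
  linarith

theorem IsExceptional.eq_of_dot_eq_neg_one {d e : Fin 9 → ℤ} (hd : IsExceptional d)
    (he : IsExceptional e) (h : dot d e = -1) : d = e := by
  have hsum := hd.sum_sq_rootCoord_sub he
  rw [h] at hsum
  have hc : ∀ k, rootCoord d k = rootCoord e k := fun k =>
    sub_eq_zero.1 <| (pow_eq_zero_iff two_ne_zero).1 <|
      (Finset.sum_eq_zero_iff_of_nonneg fun _ _ => sq_nonneg _).1 hsum k (Finset.mem_univ k)
  have hK := hd.2.trans he.2.symm
  rw [dot_KK, dot_KK] at hK
  have h0 : d 0 + d 1 + 2 * d 2 = e 0 + e 1 + 2 * e 2 := hc 0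
  have h1 : d 0 + d 1 + 2 * d 3 = e 0 + e 1 + 2 * e 3 := hc 1
  have h2 : d 0 + d 1 + 2 * d 4 = e 0 + e 1 + 2 * e 4 := hc 2
  have h3 : d 0 + d 1 + 2 * d 5 = e 0 + e 1 + 2 * e 5 := hc 3
  have h4 : d 0 + d 1 + 2 * d 6 = e 0 + e 1 + 2 * e 6 := hc 4
  have h5 : d 0 + d 1 + 2 * d 7 = e 0 + e 1 + 2 * e 7 := hc 5
  have h6 : d 0 + d 1 + 2 * d 8 = e 0 + e 1 + 2 * e 8 := hc 6
  have h7 : 5 * d 0 + d 1 + 2 * (d 2 + d 3 + d 4 + d 5 + d 6 + d 7 + d 8) =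
    5 * e 0 + e 1 + 2 * (e 2 + e 3 + e 4 + e 5 + e 6 + e 7 + e 8) := hc 7
  have e0 : d 0 = e 0 := by linarith
  have e1 : d 1 = e 1 := by linarith
  rw [e0, e1] at h0 h1 h2 h3 h4 h5 h6
  ext i
  fin_cases i
  exacts [e0, e1, by simpa using h0, by simpa using h1, by simpa using h2, by simpa using h3,
    by simpa using h4, by simpa using h5, by simpa using h6]

end Form

section Frame

/-- Twelve vectors of squared length `8` in `ℤ⁸` with mutual products `0` and `-4` form a tight
frame. -/
theorem sum_mul_eq_of_card_eq_twelve {ι : Type*} (S : Finset ι) (y : ι → Fin 8 → ℤ)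
    (hcard : S.card = 12) (hself : ∀ d ∈ S, ∑ k, y d k * y d k = 8)
    (hoff : ∀ d ∈ S, ∀ e ∈ S, d ≠ e → ∑ k, y d k * y e k = 0 ∨ ∑ k, y d k * y e k = -4)
    (k l : Fin 8) : ∑ d ∈ S, y d k * y d l = if k = l then 12 else 0 := by
  classical
  set M : Fin 8 → Fin 8 → ℤ := fun k l => ∑ d ∈ S, y d k * y d l with hM
  have htrace : ∑ k, M k k = 96 := by
    rw [Finset.sum_comm, Finset.sum_congr rfl hself]
    simp [hcard]
  have hprod : ∑ d ∈ S, ∑ e ∈ S, (∑ k, y d k * y e k) = ∑ k, (∑ d ∈ S, y d k) ^ 2 := by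
    simp_rw [sq, Finset.sum_mul_sum]
    rw [Finset.sum_comm (s := Finset.univ)]
    refine Finset.sum_congr rfl fun d _ => ?_
    rw [Finset.sum_comm]
  have hsq : ∑ k, ∑ l, M k l ^ 2 = ∑ d ∈ S, ∑ e ∈ S, (∑ k, y d k * y e k) ^ 2 := by
    simp_rw [hM, sq, Finset.sum_mul_sum]
    calc _ = ∑ p : Fin 8 × Fin 8, ∑ q ∈ S ×ˢ S,
          y q.1 p.1 * y q.1 p.2 * (y q.2 p.1 * y q.2 p.2) := by
          simp_rw [Fintype.sum_prod_type, Finset.sum_product]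
      _ = ∑ q ∈ S ×ˢ S, ∑ p : Fin 8 × Fin 8,
          y q.1 p.1 * y q.1 p.2 * (y q.2 p.1 * y q.2 p.2) := Finset.sum_comm
      _ = _ := by
          simp_rw [Fintype.sum_prod_type, Finset.sum_product, mul_mul_mul_comm]
  have hterm : ∀ d ∈ S, ∀ e ∈ S, (∑ k, y d k * y e k) ^ 2 =
      -4 * (∑ k, y d k * y e k) + if d = e then 96 else 0 := by
    intro d hd e he
    split_ifs with h
    · subst h; rw [hself d hd]; norm_num
    · rcases hoff d hd e he h with h | h <;> rw [h] <;> norm_num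
  have hle : ∑ k, ∑ l, M k l ^ 2 ≤ 1152 := by
    rw [hsq, Finset.sum_congr rfl fun d hd => Finset.sum_congr rfl (hterm d hd)]
    simp only [Finset.sum_add_distrib, ← Finset.mul_sum]
    have hdiag : ∑ d ∈ S, ∑ e ∈ S, (if d = e then (96 : ℤ) else 0) = 1152 := by
      simp [hcard]
    have : 0 ≤ ∑ k, (∑ d ∈ S, y d k) ^ 2 := Finset.sum_nonneg fun _ _ => sq_nonneg _
    rw [hprod, hdiag]
    linarith
  have hzero : ∑ k, ∑ l, (M k l - if k = l then 12 else 0) ^ 2 ≤ 0 := by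
    have : ∀ k l, (M k l - if k = l then 12 else 0) ^ 2 =
        M k l ^ 2 + if k = l then 144 - 24 * M k k else 0 := by
      intro k l
      split_ifs with h
      · subst h; ring
      · simp
    simp only [this, Finset.sum_add_distrib, Finset.sum_ite_eq, Finset.mem_univ, if_true,
      Finset.sum_sub_distrib, ← Finset.mul_sum, htrace]
    simp
    linarith
  have h1 := (Finset.sum_eq_zero_iff_of_nonneg fun _ _ => Finset.sum_nonneg fun _ _ =>
    sq_nonneg _).1 (hzero.antisymm (Finset.sum_nonneg fun _ _ => Finset.sum_nonneg fun _ _ =>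
    sq_nonneg _)) k (Finset.mem_univ k)
  have h2 := (Finset.sum_eq_zero_iff_of_nonneg fun _ _ => sq_nonneg _).1 h1 l (Finset.mem_univ l)
  exact sub_eq_zero.1 (pow_eq_zero_iff two_ne_zero |>.1 h2)

/-- Twelve exceptional vectors with mutual products `1` and `2`. -/
structure IsTwelveSet (S : Finset (Fin 9 → ℤ)) : Prop where
  exc : ∀ d ∈ S, IsExceptional d
  dot_eq : ∀ d ∈ S, ∀ e ∈ S, d ≠ e → dot d e = 1 ∨ dot d e = 2
  card : S.card = 12

namespace IsTwelveSet

variable {S : Finset (Fin 9 → ℤ)}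

theorem sum_mul (hS : IsTwelveSet S) {a c : Fin 9 → ℤ} (ha : IsExceptional a)
    (hc : IsExceptional c) :
    ∑ d ∈ S, (1 - dot d a) * (1 - dot d c) = 3 * (1 - dot a c) := by
  have hM := sum_mul_eq_of_card_eq_twelve S rootCoord hS.card
    (fun d hd => by rw [(hS.exc d hd).sum_rootCoord_mul (hS.exc d hd), (hS.exc d hd).1]; norm_num)
    (fun d hd e he h => by
      rw [(hS.exc d hd).sum_rootCoord_mul (hS.exc e he)]
      rcases hS.dot_eq d hd e he h with h | h <;> rw [h] <;> norm_num)
  have h₁ : ∑ d ∈ S, (4 * (1 - dot d a)) * (4 * (1 - dot d c)) =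
      ∑ k, ∑ l, (∑ d ∈ S, rootCoord d k * rootCoord d l) * (rootCoord a k * rootCoord c l) := by
    rw [Finset.sum_congr rfl fun d hd => by
      rw [← (hS.exc d hd).sum_rootCoord_mul ha, ← (hS.exc d hd).sum_rootCoord_mul hc,
        Finset.sum_mul_sum], Finset.sum_comm]
    refine Finset.sum_congr rfl fun k _ => ?_
    rw [Finset.sum_comm]
    refine Finset.sum_congr rfl fun l _ => ?_
    rw [Finset.sum_mul]
    exact Finset.sum_congr rfl fun d _ => by ring
  simp only [hM, ite_mul, zero_mul, Finset.sum_ite_eq, Finset.mem_univ, if_true,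
    ← Finset.mul_sum, ha.sum_rootCoord_mul hc] at h₁
  have h₂ : ∑ d ∈ S, (4 * (1 - dot d a)) * (4 * (1 - dot d c)) =
      16 * ∑ d ∈ S, (1 - dot d a) * (1 - dot d c) := by
    rw [Finset.mul_sum]
    exact Finset.sum_congr rfl fun d _ => by ring
  linarith

theorem exists_dot_eq_two (hS : IsTwelveSet S) {a : Fin 9 → ℤ} (ha : a ∈ S) :
    ∃ b ∈ S, dot b a = 2 := by
  by_contra! h
  have := hS.sum_mul (hS.exc a ha) (hS.exc a ha)
  rw [Finset.sum_eq_single_of_mem a ha fun b hb hba => ?_, (hS.exc a ha).1] at this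
  · norm_num at this
  · rw [(hS.dot_eq b hb a ha hba).resolve_right (h b hb)]; norm_num

/-- Two vectors of a twelve-set with product `2` lie in a triple with sum `-3 • KK`, and the
triple is orthogonal to the rest of the set. -/
theorem exists_triple (hS : IsTwelveSet S) {a b : Fin 9 → ℤ} (ha : a ∈ S) (hb : b ∈ S)
    (hab : dot a b = 2) : ∃ c ∈ S, c = (-3 : ℤ) • KK + (-1 : ℤ) • a + (-1 : ℤ) • b ∧
      ∀ g ∈ S, g ≠ a → g ≠ b → g ≠ c → dot g a = 1 := by
  have hea := hS.exc a ha
  have heb := hS.exc b hb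
  have hba := (dot_comm b a).trans hab
  have hne : a ≠ b := by rintro rfl; rw [hea.1] at hab; norm_num at hab
  have hcommon : ∃ c ∈ S, c ≠ a ∧ c ≠ b ∧ dot c a = 2 ∧ dot c b = 2 := by
    by_contra! h
    have := hS.sum_mul hea heb
    rw [← Finset.add_sum_erase S _ ha,
      ← Finset.add_sum_erase _ _ (Finset.mem_erase.2 ⟨hne.symm, hb⟩), Finset.sum_eq_zero,
      hea.1, heb.1, hab, hba] at this
    · norm_num at this
    · intro c hc
      simp only [Finset.mem_erase] at hc
      rcases hS.dot_eq c hc.2.2 a ha hc.2.1 with h1 | h1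
      · rw [h1]; norm_num
      · rw [(hS.dot_eq c hc.2.2 b hb hc.1).resolve_right (h c hc.2.2 hc.2.1 hc.1 h1)]; norm_num
  obtain ⟨c, hc, hca, hcb, hca2, hcb2⟩ := hcommon
  have hec := hS.exc c hc
  have hKK : dot KK KK = 1 := by decide
  have hdot : ∀ e, dot ((-3 : ℤ) • KK + (-1 : ℤ) • a + (-1 : ℤ) • b) e =
      -3 * dot KK e - dot a e - dot b e := by
    intro e
    rw [dot_add_left, dot_add_left, dot_smul_left, dot_smul_left, dot_smul_left]
    ring
  have hex : IsExceptional ((-3 : ℤ) • KK + (-1 : ℤ) • a + (-1 : ℤ) • b) := by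
    have hk := hdot KK
    rw [hKK, hea.2, heb.2] at hk
    refine ⟨?_, by rw [hk]; norm_num⟩
    rw [hdot, dot_comm KK, dot_comm a, dot_comm b, hk, hdot a, hdot b, dot_comm KK, dot_comm KK,
      hea.2, heb.2, hea.1, heb.1, hab, hba]
    norm_num
  have hceq : c = (-3 : ℤ) • KK + (-1 : ℤ) • a + (-1 : ℤ) • b := by
    refine (hex.eq_of_dot_eq_neg_one hec ?_).symm
    rw [hdot, dot_comm KK, dot_comm a, dot_comm b, hec.2, hca2, hcb2]; norm_num
  refine ⟨c, hc, hceq, fun g hg hga hgb hgc => ?_⟩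
  have h1 := hS.dot_eq g hg a ha hga
  have h2 := hS.dot_eq g hg b hb hgb
  have h3 := hS.dot_eq g hg c hc hgc
  rw [dot_comm g c, hceq, hdot, dot_comm KK, dot_comm a, dot_comm b, (hS.exc g hg).2] at h3
  omega

end IsTwelveSet

end Frame

section Enumeration

/-- The vector with the given list of coordinates. -/
def vec (l : List ℤ) : Fin 9 → ℤ := fun i => l.getD i 0

/-- The pairing `dot` on lists of coordinates. -/
def dotL (l m : List ℤ) : ℤ :=
  l.getD 0 0 * m.getD 0 0 - (l.getD 1 0 * m.getD 1 0 + l.getD 2 0 * m.getD 2 0 +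
    l.getD 3 0 * m.getD 3 0 + l.getD 4 0 * m.getD 4 0 + l.getD 5 0 * m.getD 5 0 +
    l.getD 6 0 * m.getD 6 0 + l.getD 7 0 * m.getD 7 0 + l.getD 8 0 * m.getD 8 0)

theorem dot_vec (l m : List ℤ) : dot (vec l) (vec m) = dotL l m := dot_eq _ _

theorem vec_ofFn (d : Fin 9 → ℤ) : vec (List.ofFn d) = d := by
  ext i
  fin_cases i <;> simp [vec]

/-- The lists of length `n` with entries in `[-3, 1]`, sum `s` and sum of squares `q`. -/
def latticePoints : ℕ → ℤ → ℤ → List (List ℤ)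
  | 0, s, q => if s = 0 ∧ q = 0 then [[]] else []
  | n + 1, s, q => ([-3, -2, -1, 0, 1] : List ℤ).flatMap fun x =>
      if (s - x) ^ 2 ≤ n * (q - x ^ 2) then
        (latticePoints n (s - x) (q - x ^ 2)).map (x :: ·) else []

theorem sq_sum_le_length_mul_sum_sq (l : List ℤ) : l.sum ^ 2 ≤ l.length * (l.map (· ^ 2)).sum := by
  have h := sq_sum_le_card_mul_sum_sq (s := Finset.univ) (f := fun i : Fin l.length => l.get i)
  have h₁ : ∑ i : Fin l.length, l.get i = l.sum := by simp
  have h₂ : ∑ i : Fin l.length, l.get i ^ 2 = (l.map (· ^ 2)).sum := by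
    simp [← Fin.sum_univ_fun_getElem]
  rw [h₁, h₂] at h
  simpa using h

theorem mem_latticePoints (l : List ℤ) (hl : ∀ x ∈ l, -3 ≤ x ∧ x ≤ 1) :
    l ∈ latticePoints l.length l.sum (l.map (· ^ 2)).sum := by
  induction l with
  | nil => simp [latticePoints]
  | cons x l ih =>
    simp only [List.mem_cons, forall_eq_or_imp] at hl
    have hx : x ∈ ([-3, -2, -1, 0, 1] : List ℤ) := by
      obtain ⟨⟨h₁, h₂⟩, -⟩ := hl
      simp only [List.mem_cons]
      omega
    simp only [List.length_cons, List.sum_cons, List.map_cons, latticePoints, List.mem_flatMap]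
    refine ⟨x, hx, ?_⟩
    rw [add_sub_cancel_left, add_sub_cancel_left, if_pos (sq_sum_le_length_mul_sum_sq l)]
    exact List.mem_map_of_mem (ih hl.2)

/-- The coordinate lists of all exceptional vectors. -/
def exceptionalList : List (List ℤ) :=
  ([-1, 0, 1, 2, 3, 4, 5, 6, 7] : List ℤ).flatMap fun x =>
    (latticePoints 8 (1 - 3 * x) (x ^ 2 + 1)).map (x :: ·)

theorem IsExceptional.exists_mem_exceptionalList {d : Fin 9 → ℤ} (hd : IsExceptional d) :
    ∃ l ∈ exceptionalList, vec l = d := by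
  refine ⟨List.ofFn d, ?_, vec_ofFn d⟩
  have hsq := hd.1
  have hK := hd.2
  rw [dot_eq] at hsq
  rw [dot_KK] at hK
  have hsum : (List.ofFn fun i : Fin 8 => d i.succ).sum = 1 - 3 * d 0 := by
    simp
    linarith
  have hsumsq : ((List.ofFn fun i : Fin 8 => d i.succ).map (· ^ 2)).sum = d 0 ^ 2 + 1 := by
    simp
    linarith
  have hentry : ∀ i : Fin 8, -3 ≤ d i.succ ∧ d i.succ ≤ 1 := by
    intro i
    have hi : IsExceptional (Pi.single i.succ 1) := by
      revert i; unfold IsExceptional; decide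
    have hdi : dot d (Pi.single i.succ 1) = -d i.succ := by
      simp [dot, Pi.single_apply, Fin.succ_ne_zero]
    have h₁ := hd.neg_one_le_dot hi
    have h₂ := hd.dot_le_three hi
    constructor <;> linarith
  have hmem := mem_latticePoints (List.ofFn fun i : Fin 8 => d i.succ)
    (List.forall_mem_ofFn_iff.2 hentry)
  have hcs := sq_sum_le_length_mul_sum_sq (List.ofFn fun i : Fin 8 => d i.succ)
  rw [List.length_ofFn, hsum, hsumsq] at hmem hcs
  have h₀ : d 0 ∈ ([-1, 0, 1, 2, 3, 4, 5, 6, 7] : List ℤ) := by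
    have h₁ : -1 ≤ d 0 := by push_cast at hcs; nlinarith
    have h₂ : d 0 ≤ 7 := by push_cast at hcs; nlinarith
    simp only [List.mem_cons]
    omega
  rw [List.ofFn_succ]
  exact List.mem_flatMap.2 ⟨d 0, h₀, List.mem_map_of_mem hmem⟩

end Enumeration

section Isometries

/-- The group of permutations of the lattice preserving the pairing and fixing `KK`. -/
def isometryGroup : Subgroup (Equiv.Perm (Fin 9 → ℤ)) where
  carrier := {σ | (∀ d e, dot (σ d) (σ e) = dot d e) ∧ σ KK = KK}
  one_mem' := ⟨fun _ _ => rfl, rfl⟩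
  mul_mem' {σ τ} hσ hτ := ⟨fun d e => (hσ.1 _ _).trans (hτ.1 d e), by
    rw [Equiv.Perm.mul_apply, hτ.2, hσ.2]⟩
  inv_mem' {σ} hσ := ⟨fun d e => by
    simpa using (hσ.1 (σ⁻¹ d) (σ⁻¹ e)).symm, by
    rw [Equiv.Perm.inv_eq_iff_eq, hσ.2]⟩

theorem isExceptional_apply_iff {σ : Equiv.Perm (Fin 9 → ℤ)} (hσ : σ ∈ isometryGroup)
    (d : Fin 9 → ℤ) : IsExceptional (σ d) ↔ IsExceptional d := by
  have h := hσ.1 d KK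
  rw [hσ.2] at h
  rw [IsExceptional, IsExceptional, hσ.1, h]

theorem memW_of_mem_isometryGroup {σ : Equiv.Perm (Fin 9 → ℤ)} (hσ : σ ∈ isometryGroup) :
    MemW σ :=
  ⟨σ.bijOn fun d => isExceptional_apply_iff hσ d, fun d _ e _ => hσ.1 d e⟩

/-- The reflection in a vector of square `-2`. -/
def rootReflection (r : Fin 9 → ℤ) (hr : dot r r = -2) : Equiv.Perm (Fin 9 → ℤ) :=
  Function.Involutive.toPerm (fun d => d + dot d r • r) fun d => by
    simp only [dot_add_left, dot_smul_left, hr]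
    module

theorem rootReflection_apply (r : Fin 9 → ℤ) (hr : dot r r = -2) (d : Fin 9 → ℤ) :
    rootReflection r hr d = d + dot d r • r := rfl

theorem rootReflection_of_dot_eq_zero {r : Fin 9 → ℤ} (hr : dot r r = -2) {d : Fin 9 → ℤ}
    (hd : dot d r = 0) : rootReflection r hr d = d := by
  rw [rootReflection_apply, hd, zero_smul, add_zero]

theorem rootReflection_mem {r : Fin 9 → ℤ} (hr : dot r r = -2) (hK : dot KK r = 0) :
    rootReflection r hr ∈ isometryGroup := by
  refine ⟨fun d e => ?_, rootReflection_of_dot_eq_zero hr hK⟩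
  simp only [rootReflection_apply]
  rw [dot_add_left, dot_smul_left, dot_comm d, dot_comm r, dot_add_left, dot_add_left,
    dot_smul_left, dot_smul_left, hr, dot_comm e d, dot_comm r d]
  ring

end Isometries

section Descent

/-- A system of simple roots in the orthogonal complement of `KK`. -/
def simpleRoots : List (List ℤ) :=
  [[0, 1, -1, 0, 0, 0, 0, 0, 0], [0, 0, 1, -1, 0, 0, 0, 0, 0], [0, 0, 0, 1, -1, 0, 0, 0, 0],
    [0, 0, 0, 0, 1, -1, 0, 0, 0], [0, 0, 0, 0, 0, 1, -1, 0, 0], [0, 0, 0, 0, 0, 0, 1, -1, 0],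
    [0, 0, 0, 0, 0, 0, 0, 1, -1], [1, -1, -1, -1, 0, 0, 0, 0, 0]]

/-- A vector having product `1` with every simple root. -/
def weight : List ℤ := [-5, 1, 2, 3, 4, 5, 6, 7, 8]

/-- If `l` has the prescribed products, then it is a target or it can be raised by a reflection
fixing the vectors that occur in the prescription. -/
def Descends (conds : List (List ℤ × ℤ)) (targets : List (List ℤ)) (l : List ℤ) : Prop :=
  (∀ c ∈ conds, dotL l c.1 = c.2) →
    l ∈ targets ∨ ∃ r ∈ simpleRoots, (∀ c ∈ conds, dotL c.1 r = 0) ∧ 0 < dotL l r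

instance (conds : List (List ℤ × ℤ)) (targets : List (List ℤ)) (l : List ℤ) :
    Decidable (Descends conds targets l) := by
  unfold Descends; infer_instance

/-- The prescription of product `1` with every member of `F`. -/
def disjointFrom (F : List (List ℤ)) : List (List ℤ × ℤ) := F.map (·, 1)

/-- The first triple of the standard twelve-set. -/
def tripleA : List (List ℤ) :=
  [[6, -2, -2, -2, -2, -2, -2, -2, -3], [3, -1, -1, -1, -1, -1, -1, -2, 0],
    [0, 0, 0, 0, 0, 0, 0, 1, 0]]

/-- The second triple of the standard twelve-set. -/
def tripleB : List (List ℤ) :=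
  [[5, -2, -2, -2, -2, -2, -2, -1, -1], [2, 0, 0, 0, -1, -1, -1, -1, -1],
    [2, -1, -1, -1, 0, 0, 0, -1, -1]]

/-- The third triple of the standard twelve-set. -/
def tripleX : List (List ℤ) :=
  [[3, -1, -1, -1, 0, -1, -2, -1, -1], [3, -1, -1, -1, -2, 0, -1, -1, -1],
    [3, -1, -1, -1, -1, -2, 0, -1, -1]]

/-- The fourth triple of the standard twelve-set. -/
def tripleY : List (List ℤ) :=
  [[3, 0, -1, -2, -1, -1, -1, -1, -1], [3, -2, 0, -1, -1, -1, -1, -1, -1],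
    [3, -1, -2, 0, -1, -1, -1, -1, -1]]

set_option maxRecDepth 100000 in
theorem descends_of_mem_exceptionalList : ∀ l ∈ exceptionalList,
    dotL l weight ≤ 50 ∧
    Descends (disjointFrom []) [tripleA.headI] l ∧
    Descends ((tripleA.headI, 2) :: disjointFrom []) tripleA.tail l ∧
    Descends (disjointFrom tripleA) [tripleB.headI] l ∧
    Descends ((tripleB.headI, 2) :: disjointFrom tripleA) tripleB.tail l ∧
    Descends (disjointFrom (tripleA ++ tripleB)) [tripleX.headI, tripleY.headI] l ∧
    Descends ((tripleX.headI, 2) :: disjointFrom (tripleA ++ tripleB)) tripleX.tail l ∧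
    Descends ((tripleY.headI, 2) :: disjointFrom (tripleA ++ tripleB)) tripleY.tail l ∧
    Descends (disjointFrom (tripleA ++ tripleB ++ tripleX)) [tripleY.headI] l ∧
    Descends (disjointFrom (tripleA ++ tripleB ++ tripleY)) [tripleX.headI] l ∧
    Descends ((tripleY.headI, 2) :: disjointFrom (tripleA ++ tripleB ++ tripleX)) tripleY.tail l ∧
    Descends ((tripleX.headI, 2) :: disjointFrom (tripleA ++ tripleB ++ tripleY)) tripleX.tail l := by
  decide +kernel

theorem IsExceptional.exists_apply_mem_targets {conds : List (List ℤ × ℤ)}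
    {targets : List (List ℤ)} (h : ∀ l ∈ exceptionalList, Descends conds targets l)
    {d : Fin 9 → ℤ} (hd : IsExceptional d) (hc : ∀ c ∈ conds, dot d (vec c.1) = c.2) :
    ∃ σ ∈ isometryGroup, (∀ c ∈ conds, σ (vec c.1) = vec c.1) ∧ ∃ t ∈ targets, σ d = vec t := by
  induction hn : (50 - dot d (vec weight)).toNat using Nat.strong_induction_on generalizing d with
  | _ n ih =>
  obtain ⟨l, hl, rfl⟩ := hd.exists_mem_exceptionalList
  have hroots : ∀ r ∈ simpleRoots, dotL r r = -2 ∧ dot KK (vec r) = 0 ∧ dotL r weight = 1 := by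
    decide
  rcases h l hl fun c hcm => (dot_vec _ _).symm.trans (hc c hcm) with ht | ⟨r, hr, hrc, hpos⟩
  · exact ⟨1, one_mem _, fun _ _ => rfl, l, ht, rfl⟩
  · obtain ⟨hr2, hrK, hrw⟩ := hroots r hr
    rw [← dot_vec] at hr2 hrw hpos
    have hs := rootReflection_mem hr2 hrK
    have hfix : ∀ c ∈ conds, rootReflection (vec r) hr2 (vec c.1) = vec c.1 := fun c hcm =>
      rootReflection_of_dot_eq_zero hr2 ((dot_vec _ _).trans (hrc c hcm))
    have hd' := (isExceptional_apply_iff hs (vec l)).2 hd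
    have hw : dot (rootReflection (vec r) hr2 (vec l)) (vec weight) =
        dot (vec l) (vec weight) + dot (vec l) (vec r) := by
      rw [rootReflection_apply, dot_add_left, dot_smul_left, hrw, mul_one]
    have hle : dot (rootReflection (vec r) hr2 (vec l)) (vec weight) ≤ 50 := by
      obtain ⟨m, hm, hme⟩ := hd'.exists_mem_exceptionalList
      rw [← hme, dot_vec]
      exact (descends_of_mem_exceptionalList m hm).1
    obtain ⟨σ, hσ, hσf, t, ht, hσt⟩ := ih _ (by omega) hd' (fun c hcm => by
      rw [← hc c hcm]
      conv_lhs => rw [← hfix c hcm]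
      exact hs.1 _ _) rfl
    refine ⟨σ * rootReflection (vec r) hr2, mul_mem hσ hs, fun c hcm => ?_, t, ht, hσt⟩
    rw [Equiv.Perm.mul_apply, hfix c hcm, hσf c hcm]

end Descent

section Transitivity

theorem IsTwelveSet.map {S : Finset (Fin 9 → ℤ)} (hS : IsTwelveSet S)
    {σ : Equiv.Perm (Fin 9 → ℤ)} (hσ : σ ∈ isometryGroup) :
    IsTwelveSet (S.map σ.toEmbedding) where
  exc := by
    simp only [Finset.forall_mem_map]
    exact fun d hd => (isExceptional_apply_iff hσ d).2 (hS.exc d hd)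
  dot_eq := by
    simp only [Finset.forall_mem_map]
    intro d hd e he hde
    have := hS.dot_eq d hd e he (by rintro rfl; exact hde rfl)
    rwa [← hσ.1 d e] at this
  card := by rw [Finset.card_map, hS.card]

theorem map_perm_mul {α : Type*} (S : Finset α) (τ σ : Equiv.Perm α) :
    S.map (τ * σ).toEmbedding = (S.map σ.toEmbedding).map τ.toEmbedding := by
  rw [Finset.map_map]; rfl

/-- `S` can be mapped by an isometry onto a set containing all vectors listed in `F`. -/
def Reaches (S : Finset (Fin 9 → ℤ)) (F : List (List ℤ)) : Prop :=
  ∃ σ ∈ isometryGroup, ∀ f ∈ F, vec f ∈ S.map σ.toEmbedding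

/-- `F` is a union of triples with sum `-3 • KK`. -/
def IsTripleUnion (F : List (List ℤ)) : Prop :=
  ∀ a ∈ F, ∃ b ∈ F, dotL a b = 2 ∧ ∃ c ∈ F,
    vec c = (-3 : ℤ) • KK + (-1 : ℤ) • vec a + (-1 : ℤ) • vec b

instance (F : List (List ℤ)) : Decidable (IsTripleUnion F) := by
  unfold IsTripleUnion; infer_instance

theorem IsTwelveSet.dot_eq_one {S : Finset (Fin 9 → ℤ)} (hS : IsTwelveSet S)
    {F : List (List ℤ)} (hF : IsTripleUnion F) (hFS : ∀ f ∈ F, vec f ∈ S) {g : Fin 9 → ℤ}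
    (hg : g ∈ S) (hgF : ∀ f ∈ F, vec f ≠ g) {f : List ℤ} (hf : f ∈ F) : dot g (vec f) = 1 := by
  obtain ⟨b, hb, hfb, c, hc, hceq⟩ := hF f hf
  obtain ⟨c', -, hc', hdot⟩ := hS.exists_triple (hFS f hf) (hFS b hb) ((dot_vec _ _).trans hfb)
  refine hdot g hg (hgF f hf).symm (hgF b hb).symm ?_
  rw [hc', ← hceq]
  exact (hgF c hc).symm

theorem Reaches.exists_cons {S : Finset (Fin 9 → ℤ)} (hS : IsTwelveSet S) {F : List (List ℤ)}
    (hr : Reaches S F) (hF : IsTripleUnion F) (hlen : F.length < 12) {targets : List (List ℤ)}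
    (h : ∀ l ∈ exceptionalList, Descends (disjointFrom F) targets l) :
    ∃ t ∈ targets, Reaches S (t :: F) := by
  classical
  obtain ⟨σ, hσ, hFS⟩ := hr
  have hS' := hS.map hσ
  obtain ⟨g, hg, hgF⟩ : ∃ g ∈ S.map σ.toEmbedding, g ∉ (F.map vec).toFinset :=
    Finset.exists_mem_notMem_of_card_lt_card
      ((List.toFinset_card_le _).trans_lt (by rwa [List.length_map, hS'.card]))
  have hgF' : ∀ f ∈ F, vec f ≠ g := by simpa using hgF
  obtain ⟨τ, hτ, hfix, t, ht, hgt⟩ := (hS'.exc g hg).exists_apply_mem_targets h (by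
    simpa [disjointFrom] using fun f hf => hS'.dot_eq_one hF hFS hg hgF' hf)
  refine ⟨t, ht, τ * σ, mul_mem hτ hσ, ?_⟩
  rw [map_perm_mul]
  simp only [List.mem_cons, forall_eq_or_imp]
  refine ⟨hgt ▸ Finset.mem_map_of_mem _ hg, fun f hf => ?_⟩
  rw [← hfix (f, 1) (List.mem_map_of_mem hf)]
  exact Finset.mem_map_of_mem _ (hFS f hf)

theorem Reaches.append {S : Finset (Fin 9 → ℤ)} (hS : IsTwelveSet S) {F T : List (List ℤ)}
    (hr : Reaches S (T.headI :: F)) (hF : IsTripleUnion F) (hx : ∀ f ∈ F, vec f ≠ vec T.headI)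
    (hT : ∀ b ∈ T.tail, ∀ c ∈ T, vec c = vec T.headI ∨ vec c = vec b ∨
      vec c = (-3 : ℤ) • KK + (-1 : ℤ) • vec T.headI + (-1 : ℤ) • vec b)
    (h : ∀ l ∈ exceptionalList, Descends ((T.headI, 2) :: disjointFrom F) T.tail l) :
    Reaches S (F ++ T) := by
  obtain ⟨σ, hσ, hFS⟩ := hr
  simp only [List.mem_cons, forall_eq_or_imp] at hFS
  obtain ⟨hxS, hFS⟩ := hFS
  have hS' := hS.map hσ
  obtain ⟨g, hg, hgx⟩ := hS'.exists_dot_eq_two hxS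
  have hgF : ∀ f ∈ F, vec f ≠ g := by
    rintro f hf rfl
    have := hS'.dot_eq_one hF hFS hxS hx hf
    rw [dot_comm, this] at hgx
    norm_num at hgx
  obtain ⟨τ, hτ, hfix, b, hb, hgb⟩ := (hS'.exc g hg).exists_apply_mem_targets h (by
    simpa [disjointFrom, hgx] using fun f hf => hS'.dot_eq_one hF hFS hg hgF hf)
  refine ⟨τ * σ, mul_mem hτ hσ, ?_⟩
  rw [map_perm_mul]
  have hS'' := hS'.map hτ
  have hFS' : ∀ f ∈ F, vec f ∈ (S.map σ.toEmbedding).map τ.toEmbedding := fun f hf => by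
    rw [← hfix (f, 1) (List.mem_cons_of_mem _ (List.mem_map_of_mem hf))]
    exact Finset.mem_map_of_mem _ (hFS f hf)
  have hxfix := hfix (T.headI, 2) List.mem_cons_self
  have hxS' : vec T.headI ∈ (S.map σ.toEmbedding).map τ.toEmbedding := by
    rw [← hxfix]
    exact Finset.mem_map_of_mem _ hxS
  have hbS : vec b ∈ (S.map σ.toEmbedding).map τ.toEmbedding :=
    hgb ▸ Finset.mem_map_of_mem _ hg
  have hxb : dot (vec T.headI) (vec b) = 2 := by
    rw [← hgb, ← hxfix, hτ.1, dot_comm, hgx]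
  obtain ⟨c, hc, hceq, -⟩ := hS''.exists_triple hxS' hbS hxb
  intro f hf
  rcases List.mem_append.1 hf with hf | hf
  · exact hFS' f hf
  · rcases hT b hb f hf with h | h | h <;> rw [h]
    exacts [hxS', hbS, hceq ▸ hc]

/-- The standard twelve-set. -/
def standardSet : List (List ℤ) := tripleA ++ tripleB ++ tripleX ++ tripleY

theorem IsTwelveSet.reaches_standardSet {S : Finset (Fin 9 → ℤ)} (hS : IsTwelveSet S) :
    Reaches S standardSet := by
  have H := descends_of_mem_exceptionalList
  have h₀ : Reaches S [] := ⟨1, one_mem _, by simp⟩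
  obtain ⟨a, ha, hA⟩ := h₀.exists_cons hS (by decide) (by decide) fun l hl => (H l hl).2.1
  rw [List.mem_singleton] at ha; subst ha
  replace hA := hA.append hS (by decide) (by decide) (by decide) fun l hl => (H l hl).2.2.1
  obtain ⟨b, hb, hB⟩ := hA.exists_cons hS (by decide) (by decide) fun l hl => (H l hl).2.2.2.1
  rw [List.mem_singleton] at hb; subst hb
  replace hB := hB.append hS (by decide) (by decide) (by decide) fun l hl => (H l hl).2.2.2.2.1
  obtain ⟨x, hx, hX⟩ := hB.exists_cons hS (by decide) (by decide)
    fun l hl => (H l hl).2.2.2.2.2.1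
  simp only [List.mem_cons, List.not_mem_nil, or_false] at hx
  rcases hx with rfl | rfl
  · replace hX := hX.append hS (by decide) (by decide) (by decide)
      fun l hl => (H l hl).2.2.2.2.2.2.1
    obtain ⟨y, hy, hY⟩ := hX.exists_cons hS (by decide) (by decide)
      fun l hl => (H l hl).2.2.2.2.2.2.2.2.1
    rw [List.mem_singleton] at hy; subst hy
    exact hY.append hS (by decide) (by decide) (by decide)
      fun l hl => (H l hl).2.2.2.2.2.2.2.2.2.2.1
  · replace hX := hX.append hS (by decide) (by decide) (by decide)
      fun l hl => (H l hl).2.2.2.2.2.2.2.1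
    obtain ⟨y, hy, hY⟩ := hX.exists_cons hS (by decide) (by decide)
      fun l hl => (H l hl).2.2.2.2.2.2.2.2.2.1
    rw [List.mem_singleton] at hy; subst hy
    obtain ⟨σ, hσ, hσS⟩ := hY.append hS (by decide) (by decide) (by decide)
      fun l hl => (H l hl).2.2.2.2.2.2.2.2.2.2.2
    refine ⟨σ, hσ, fun f hf => hσS f ?_⟩
    simp only [standardSet, List.nil_append, List.mem_append] at hf ⊢
    exact or_right_comm.1 hf

theorem IsTwelveSet.exists_map_eq {S : Finset (Fin 9 → ℤ)} (hS : IsTwelveSet S) :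
    ∃ σ ∈ isometryGroup, S.map σ.toEmbedding = (standardSet.map vec).toFinset := by
  obtain ⟨σ, hσ, h⟩ := hS.reaches_standardSet
  refine ⟨σ, hσ, (Finset.eq_of_subset_of_card_le (fun d hd => ?_) ?_).symm⟩
  · obtain ⟨f, hf, rfl⟩ := List.mem_map.1 (List.mem_toFinset.1 hd)
    exact h f hf
  · rw [Finset.card_map, hS.card, List.toFinset_card_of_nodup (by decide +kernel), List.length_map]
    decide

end Transitivity

/-- `W` acts transitively on the sets of 12 exceptional vectors whose pairwise products all
lie in {1, 2}. -/
theorem stmt_11 (S₁ S₂ : Finset (Fin 9 → ℤ))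
    (h₁exc : ∀ d ∈ S₁, IsExceptional d) (h₂exc : ∀ d ∈ S₂, IsExceptional d)
    (h₁ : ∀ d ∈ S₁, ∀ e ∈ S₁, d ≠ e → dot d e = 1 ∨ dot d e = 2)
    (h₂ : ∀ d ∈ S₂, ∀ e ∈ S₂, d ≠ e → dot d e = 1 ∨ dot d e = 2)
    (h₁card : S₁.card = 12) (h₂card : S₂.card = 12) :
    ∃ σ : (Fin 9 → ℤ) → (Fin 9 → ℤ), MemW σ ∧ σ '' (S₁ : Set (Fin 9 → ℤ)) = S₂ := by
  obtain ⟨σ, hσ, hσS⟩ := IsTwelveSet.exists_map_eq ⟨h₁exc, h₁, h₁card⟩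
  obtain ⟨τ, hτ, hτS⟩ := IsTwelveSet.exists_map_eq ⟨h₂exc, h₂, h₂card⟩
  refine ⟨⇑(τ⁻¹ * σ), memW_of_mem_isometryGroup (mul_mem (inv_mem hτ) hσ), ?_⟩
  have h : σ '' (S₁ : Set (Fin 9 → ℤ)) = τ '' (S₂ : Set (Fin 9 → ℤ)) := by
    simpa using congrArg (fun S : Finset (Fin 9 → ℤ) => (S : Set (Fin 9 → ℤ)))
      (hσS.trans hτS.symm)
  rw [Equiv.Perm.coe_mul, Set.image_comp, h, ← Set.image_comp, ← Equiv.Perm.coe_mul,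
    inv_mul_cancel, Equiv.Perm.coe_one, Set.image_id]
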